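/- Let q = 4 and let π be the transposition of {0,1,2,3} exchanging 0 and 3, so that R_π exchanges [0,1/4) and [3/4,1) by translation and fixes [1/4,3/4) pointwise. Then for the rotated odometer F_π: every x ∈ [1/4,1) satisfies F_π³(x) = x but F_π(x) ≠ x and F_π²(x) ≠ x (so x is periodic of minimal period 3), and no x ∈ [0,1/4) is periodic under F_π. -/

import Mathlib

open MeasureTheory Set Function
open scoped ENNReal

noncomputable section

/-- `A` is the von Neumann–Kakutani map on `[0,1)`:
`A x = x - (1 - 3·2⁻ⁿ)` for `x ∈ [1 - 2^(1-n), 1 - 2^(-n))`, `n ≥ 1`. -/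
def IsVNK (A : ℝ → ℝ) : Prop :=
  ∀ n : ℕ, 1 ≤ n →
    ∀ x ∈ Set.Ico (1 - (2:ℝ) ^ (1 - (n:ℤ))) (1 - (2:ℝ) ^ (-(n:ℤ))),
      A x = x - (1 - 3 * (2:ℝ) ^ (-(n:ℤ)))

/-- `R` is the interval exchange of the `q` intervals of length `1/q` determined by the
permutation `π`: `R x = x + (π p - p)/q` for `x ∈ [p/q, (p+1)/q)`. -/
def IsIET (q : ℕ) (π : Equiv.Perm (Fin q)) (R : ℝ → ℝ) : Prop :=
  ∀ p : Fin q,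
    ∀ x ∈ Set.Ico (((p : ℕ) : ℝ) / (q : ℝ)) ((((p : ℕ) : ℝ) + 1) / (q : ℝ)),
      R x = x + (((π p : ℕ) : ℝ) - ((p : ℕ) : ℝ)) / (q : ℝ)

/-- The set of periodic points of `F` in `[0,1)`. -/
def Iper (F : ℝ → ℝ) : Set ℝ :=
  {x ∈ Set.Ico (0:ℝ) 1 | ∃ k, 1 ≤ k ∧ F^[k] x = x}

/-- The set of non-periodic points of `F` in `[0,1)`. -/
def Inp (F : ℝ → ℝ) : Set ℝ := Set.Ico (0:ℝ) 1 \ Iper F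

/-- Natural-power form of the defining formula of the von Neumann–Kakutani map. -/
lemma isVNK_iff (A : ℝ → ℝ) : IsVNK A ↔ ∀ (m : ℕ) (x : ℝ), 1 - (1/2 : ℝ) ^ m ≤ x →
    x < 1 - (1/2 : ℝ) ^ m / 2 → A x = x - (1 - 3 * ((1/2 : ℝ) ^ m / 2)) := by
  have h1 (m : ℕ) : (2:ℝ) ^ (1 - ((m + 1 : ℕ) : ℤ)) = (1/2 : ℝ) ^ m := by
    rw [show (1 - ((m + 1 : ℕ) : ℤ)) = -(m : ℤ) by push_cast; ring, zpow_neg, zpow_natCast,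
      one_div, inv_pow]
  have h2 (m : ℕ) : (2:ℝ) ^ (-((m + 1 : ℕ) : ℤ)) = (1/2 : ℝ) ^ m / 2 := by
    rw [zpow_neg, zpow_natCast, one_div, inv_pow, pow_succ, mul_inv, div_eq_mul_inv]
  constructor
  · intro h m x hx hx'
    have := h (m + 1) (by omega) x
    rw [h1, h2] at this
    exact this ⟨hx, hx'⟩
  · intro h n hn x hx
    obtain ⟨m, rfl⟩ : ∃ m, n = m + 1 := ⟨n - 1, by omega⟩
    rw [h1, h2] at hx
    rw [h2]
    exact h m x hx.1 hx.2

lemma exists_dyadic_level {x : ℝ} (hx : x ∈ Ico (0 : ℝ) 1) :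
    ∃ m : ℕ, 1 - (1/2 : ℝ) ^ m ≤ x ∧ x < 1 - (1/2 : ℝ) ^ m / 2 := by
  obtain ⟨m, h1, h2⟩ := exists_nat_pow_near_of_lt_one (x := 1 - x) (y := (1/2 : ℝ))
    (by linarith [hx.2]) (by linarith [hx.1]) (by norm_num) (by norm_num)
  rw [pow_succ] at h1
  exact ⟨m, by linarith, by linarith⟩

namespace IsVNK

variable {A : ℝ → ℝ}

lemma apply_of_lt_half (hA : IsVNK A) {x : ℝ} (hx : x ∈ Ico (0 : ℝ) (1/2)) :
    A x = x + 1/2 := by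
  have := (isVNK_iff A).1 hA 0 x (by norm_num; exact hx.1) (by norm_num; linarith [hx.2])
  rw [this]; norm_num

lemma apply_of_mem_third_quarter (hA : IsVNK A) {x : ℝ} (hx : x ∈ Ico (1/2 : ℝ) (3/4)) :
    A x = x - 1/4 := by
  have := (isVNK_iff A).1 hA 1 x (by linarith [hx.1]) (by linarith [hx.2])
  rw [this]; norm_num

lemma apply_mem_of_half_le (hA : IsVNK A) {x : ℝ} (hx : x ∈ Ico (1/2 : ℝ) 1) :
    A x ∈ Ico (0 : ℝ) (1/2) := by
  obtain ⟨m, h1, h2⟩ := exists_dyadic_level ⟨by linarith [hx.1], hx.2⟩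
  rw [(isVNK_iff A).1 hA m x h1 h2]
  have hp : (0 : ℝ) < (1/2) ^ m := by positivity
  have hp' : (1/2 : ℝ) ^ m ≤ 1/2 := by
    rcases m with _ | m
    · norm_num at h2
      linarith [hx.1]
    · rw [pow_succ]
      linarith [pow_le_one₀ (n := m) (by norm_num : (0:ℝ) ≤ 1/2) (by norm_num)]
  constructor <;> linarith

lemma mapsTo (hA : IsVNK A) : MapsTo A (Ico 0 1) (Ico 0 1) := by
  intro x hx
  rcases lt_or_ge x (1/2) with h | h
  · rw [hA.apply_of_lt_half ⟨hx.1, h⟩]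
    constructor <;> linarith [hx.1]
  · have := hA.apply_mem_of_half_le ⟨h, hx.2⟩
    exact ⟨this.1, by linarith [this.2]⟩

/-- The second iterate on `[0,1/2)` is a half-scale copy of the map itself. -/
lemma apply_apply_half (hA : IsVNK A) {y : ℝ} (hy : y ∈ Ico (0 : ℝ) 1) :
    A (A (y / 2)) = A y / 2 := by
  rw [hA.apply_of_lt_half (x := y / 2) ⟨by linarith [hy.1], by linarith [hy.2]⟩]
  obtain ⟨m, h1, h2⟩ := exists_dyadic_level hy
  rw [(isVNK_iff A).1 hA m y h1 h2, (isVNK_iff A).1 hA (m + 1) (y / 2 + 1/2)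
    (by rw [pow_succ]; linarith) (by rw [pow_succ]; linarith), pow_succ]
  ring

lemma iterate_two_mul_half (hA : IsVNK A) (j : ℕ) {y : ℝ} (hy : y ∈ Ico (0 : ℝ) 1) :
    A^[2 * j] (y / 2) = A^[j] y / 2 := by
  induction j generalizing y with
  | zero => rfl
  | succ j ih =>
    rw [show 2 * (j + 1) = 2 * j + 1 + 1 by ring, iterate_succ_apply, iterate_succ_apply,
      hA.apply_apply_half hy, ih (hA.mapsTo hy), iterate_succ_apply]

/-- The von Neumann–Kakutani map has no periodic points. -/
lemma iterate_ne (hA : IsVNK A) (k : ℕ) (hk : 1 ≤ k) {x : ℝ} (hx : x ∈ Ico (0 : ℝ) 1) :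
    A^[k] x ≠ x := by
  induction k using Nat.strong_induction_on generalizing x with
  | _ k ih =>
    have lower : ∀ {z : ℝ}, z ∈ Ico (0 : ℝ) (1/2) → A^[k] z ≠ z := by
      intro z hz hfix
      have hy : 2 * z ∈ Ico (0 : ℝ) 1 := ⟨by linarith [hz.1], by linarith [hz.2]⟩
      have hz2 : z = 2 * z / 2 := by ring
      rcases Nat.even_or_odd' k with ⟨j, rfl | rfl⟩
      · rw [hz2, hA.iterate_two_mul_half j hy] at hfix
        exact ih j (by omega) (by omega) hy (by linarith)
      · rw [iterate_succ_apply', hz2, hA.iterate_two_mul_half j hy] at hfix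
        have hm := hA.mapsTo.iterate j hy
        rw [hA.apply_of_lt_half ⟨by linarith [hm.1], by linarith [hm.2]⟩] at hfix
        linarith [hm.1, hz.2]
    rcases lt_or_ge x (1/2) with h | h
    · exact lower ⟨hx.1, h⟩
    · intro hfix
      apply lower (hA.apply_mem_of_half_le ⟨h, hx.2⟩)
      rw [← iterate_succ_apply, iterate_succ_apply', hfix]

end IsVNK

/-- for `q = 4` and `π` the transposition exchanging `0` and `3`, every
`x ∈ [1/4, 1)` is periodic of minimal period `3` under the rotated odometer
`F_π = ā ∘ R_π`, and no `x ∈ [0, 1/4)` is periodic. -/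
theorem stmt14 (π : Equiv.Perm (Fin 4)) (hπ : π = Equiv.swap (0 : Fin 4) 3)
    (A R F : ℝ → ℝ) (hA : IsVNK A) (hR : IsIET 4 π R) (hF : ∀ x, F x = A (R x)) :
    (∀ x ∈ Set.Ico (1/4 : ℝ) 1, F^[3] x = x ∧ F x ≠ x ∧ F^[2] x ≠ x) ∧
    (∀ x ∈ Set.Ico (0 : ℝ) (1/4), ¬ ∃ k, 1 ≤ k ∧ F^[k] x = x) := by
  subst hπ
  have p0 : Equiv.swap (0 : Fin 4) 3 0 = 3 := by decide
  have p1 : Equiv.swap (0 : Fin 4) 3 1 = 1 := by decide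
  have p2 : Equiv.swap (0 : Fin 4) 3 2 = 2 := by decide
  have p3 : Equiv.swap (0 : Fin 4) 3 3 = 0 := by decide
  have R0 : ∀ x ∈ Ico (0 : ℝ) (1/4), R x = x + 3/4 := by
    intro x hx
    have := hR 0 x (by norm_num; exact ⟨hx.1, by linarith [hx.2]⟩)
    rw [this, p0]; norm_num
  have F1 : ∀ x ∈ Ico (1/4 : ℝ) (1/2), F x = x + 1/2 := by
    intro x hx
    have := hR 1 x (by norm_num; exact ⟨by linarith [hx.1], by linarith [hx.2]⟩)
    rw [p1, sub_self, zero_div, add_zero] at this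
    rw [hF, this, hA.apply_of_lt_half ⟨by linarith [hx.1], hx.2⟩]
  have F2 : ∀ x ∈ Ico (1/2 : ℝ) (3/4), F x = x - 1/4 := by
    intro x hx
    have := hR 2 x (by norm_num; exact ⟨by linarith [hx.1], by linarith [hx.2]⟩)
    rw [p2, sub_self, zero_div, add_zero] at this
    rw [hF, this, hA.apply_of_mem_third_quarter hx]
  have F3 : ∀ x ∈ Ico (3/4 : ℝ) 1, F x = x - 1/4 := by
    intro x hx
    have := hR 3 x (by norm_num; exact ⟨by linarith [hx.1], by linarith [hx.2]⟩)
    rw [p3] at this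
    have hRx : R x = x - 3/4 := by rw [this]; norm_num; ring
    rw [hF, hRx, hA.apply_of_lt_half ⟨by linarith [hx.1], by linarith [hx.2]⟩]
    ring
  constructor
  · intro x hx
    simp only [iterate_succ_apply, iterate_zero_apply]
    rcases lt_or_ge x (1/2) with h | h
    · rw [F1 x ⟨hx.1, h⟩, F3 (x + 1/2) ⟨by linarith [hx.1], by linarith⟩,
        F2 _ ⟨by linarith [hx.1], by linarith⟩]
      refine ⟨by ring, fun h => by linarith, fun h => by linarith⟩
    rcases lt_or_ge x (3/4) with h' | h'
    · rw [F2 x ⟨h, h'⟩, F1 (x - 1/4) ⟨by linarith, by linarith⟩,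
        F3 _ ⟨by linarith, by linarith⟩]
      refine ⟨by ring, fun h => by linarith, fun h => by linarith⟩
    · rw [F3 x ⟨h', hx.2⟩, F2 (x - 1/4) ⟨by linarith, by linarith [hx.2]⟩,
        F1 _ ⟨by linarith, by linarith [hx.2]⟩]
      refine ⟨by ring, fun h => by linarith, fun h => by linarith⟩
  · rintro x hx ⟨k, hk, hfix⟩
    have hG : IsVNK (fun y => 4 * F (y / 4)) := by
      rw [isVNK_iff]
      intro m y h1 h2
      have hp : (0 : ℝ) < (1/2) ^ m := by positivity
      have hp' : (1/2 : ℝ) ^ m ≤ 1 := pow_le_one₀ (by norm_num) (by norm_num)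
      have h4 : (1/2 : ℝ) ^ (m + 2) = (1/2) ^ m / 4 := by rw [pow_add]; ring
      simp only [hF]
      rw [R0 (y / 4) ⟨by linarith, by linarith⟩, (isVNK_iff A).1 hA (m + 2) _
        (by rw [h4]; linarith) (by rw [h4]; linarith), h4]
      ring
    have hsemi : Semiconj (fun z : ℝ => 4 * z) F (fun y => 4 * F (y / 4)) := fun z => by
      simp only [mul_div_cancel_left₀ z (four_ne_zero' ℝ)]
    refine hG.iterate_ne k hk (x := 4 * x) ⟨by linarith [hx.1], by linarith [hx.2]⟩ ?_
    rw [← (hsemi.iterate_right k).eq x, hfix]
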